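/- arXiv:1904.04658 — 2 statements merged into one kernel-verified Lean document; each statement's English description precedes it below -/
import Mathlib

section
/- Let G be a finitely generated group splitting over a finite subgroup, and let Γ be its Cayley graph with respect to a finite generating set. Then Γ has the finite-step retaining property: there is a constant f such that every finite initial fire X_0 (reach one) admits a retaining f-strategy {W_n} with W_n = ∅ for all but finitely many n. -/
/-- The growth comparison relation: `f ≼ g` iff there is `C > 0` with
`f n ≤ C * g (C*n + C) + C` for all `n`. -/
def GrowthLE (f g : ℕ → ℕ) : Prop :=
  ∃ C : ℕ, 0 < C ∧ ∀ n, f n ≤ C * g (C * n + C) + C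

/-- Equivalence of growth rates. -/
def GrowthEquiv (f g : ℕ → ℕ) : Prop := GrowthLE f g ∧ GrowthLE g f

/-- The growth function of a subset `U` of a metric space, with basepoint set `A`:
`n ↦ #(U ∩ B(A, n))`. -/
noncomputable def relGrowth {X : Type*} [MetricSpace X] (U A : Set X) : ℕ → ℕ :=
  fun n => Set.ncard {x | x ∈ U ∧ ∃ a ∈ A, dist a x ≤ (n : ℝ)}

/-- A metric space is discrete and proper iff all balls (of integer radius) are finite. -/
def DiscreteProper (X : Type*) [MetricSpace X] : Prop :=
  ∀ (x : X) (n : ℕ), {y : X | dist x y ≤ (n : ℝ)}.Finite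

/-- Uniformly proper: there is a uniform bound on cardinalities of all balls of radius `n`. -/
def UniformlyProper (X : Type*) [MetricSpace X] : Prop :=
  ∃ g : ℕ → ℕ, ∀ (x : X) (n : ℕ),
    {y : X | dist x y ≤ (n : ℝ)}.Finite ∧ Set.ncard {y : X | dist x y ≤ (n : ℝ)} ≤ g n

/-- A `c`-quasi-isometry between metric spaces. -/
def IsQuasiIsometryMS {X Y : Type*} [MetricSpace X] [MetricSpace Y] (c : ℝ) (φ : X → Y) : Prop :=
  1 ≤ c ∧
  (∀ a b : X, dist a b / c - c ≤ dist (φ a) (φ b) ∧ dist (φ a) (φ b) ≤ c * dist a b + c) ∧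
  (∀ y : Y, ∃ x : X, dist (φ x) y ≤ c)

/-- Growth function of `U ⊆ V(G)` (with the metric induced by the path-metric of `G`)
with respect to basepoint set `A`. -/
noncomputable def graphGrowth {V : Type*} (G : SimpleGraph V) (U A : Set V) : ℕ → ℕ :=
  fun n => Set.ncard {v | v ∈ U ∧ ∃ a ∈ A, G.dist a v ≤ n}

/-- `Growth(U) = Growth(G)` for `U` a set of vertices of `G` with the induced metric. -/
def GrowthEqFull {V : Type*} (G : SimpleGraph V) (U : Set V) : Prop :=
  ∃ u₀ ∈ U, GrowthEquiv (graphGrowth G Set.univ {u₀}) (graphGrowth G U {u₀})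

/-- The set of vertices protected up to (and including) time `n`. -/
def protectedUpTo {V : Type*} (W : ℕ → Set V) (n : ℕ) : Set V :=
  ⋃ i ∈ Finset.Icc 1 n, W i

/-- The set of vertices on fire at time `n`, for fire reach `r`, strategy `W` and
initial fire `X0`: `X (n+1)` consists of vertices joined to `X n` by a path of length
at most `r` avoiding `(W 1 ∪ ⋯ ∪ W (n+1)) \ X n`. -/
def fireSet {V : Type*} (G : SimpleGraph V) (r : ℕ) (W : ℕ → Set V) (X0 : Set V) : ℕ → Set V
  | 0 => X0
  | n + 1 =>
    {v | ∃ u ∈ fireSet G r W X0 n, ∃ p : G.Walk u v, p.length ≤ r ∧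
      ∀ x ∈ p.support, x ∉ protectedUpTo W (n + 1) \ fireSet G r W X0 n}

/-- The set of vertices on fire at the end of the game. -/
def burnedSet {V : Type*} (G : SimpleGraph V) (r : ℕ) (W : ℕ → Set V) (X0 : Set V) : Set V :=
  ⋃ n, fireSet G r W X0 n

/-- An `{f n}`-strategy: at each time `n ≥ 1` at most `f n` vertices are protected. -/
def IsStrategyBound {V : Type*} (f : ℕ → ℕ) (W : ℕ → Set V) : Prop :=
  ∀ n, 1 ≤ n → (W n).Finite ∧ (W n).ncard ≤ f n

/-- A finite-step strategy protects no vertices after some finite time. -/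
def FiniteStepStrategy {V : Type*} (W : ℕ → Set V) : Prop :=
  ∃ N, ∀ n, N ≤ n → W n = ∅

/-- A retaining `({f n}, r)`-strategy for the initial fire `X0`. -/
def IsRetainingStrategy {V : Type*} (G : SimpleGraph V) (f : ℕ → ℕ) (r : ℕ)
    (X0 : Set V) (W : ℕ → Set V) : Prop :=
  IsStrategyBound f W ∧ GrowthEqFull G (burnedSet G r W X0)ᶜ

/-- The `({f n}, r)`-retaining property. -/
def RetainingProperty {V : Type*} (G : SimpleGraph V) (f : ℕ → ℕ) (r : ℕ) : Prop :=
  ∀ X0 : Set V, X0.Finite → ∃ W, IsRetainingStrategy G f r X0 W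

/-- Polynomial retaining property of degree `d` (fire reach one). -/
def PolyRetaining {V : Type*} (G : SimpleGraph V) (d : ℕ) : Prop :=
  ∃ K : ℕ, 0 < K ∧ RetainingProperty G (fun n => K * n ^ d) 1

/-- The finite-step `{f n}`-retaining property (fire reach one). -/
def FiniteStepRetainingProperty {V : Type*} (G : SimpleGraph V) (f : ℕ → ℕ) : Prop :=
  ∀ X0 : Set V, X0.Finite → ∃ W, IsRetainingStrategy G f 1 X0 W ∧ FiniteStepStrategy W

/-- The finite-step polynomial retaining property of degree `d`. -/
def FiniteStepPolyRetaining {V : Type*} (G : SimpleGraph V) (d : ℕ) : Prop :=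
  ∃ K : ℕ, 0 < K ∧ FiniteStepRetainingProperty G (fun n => K * n ^ d)

/-- The `({f n}, r)`-containment property. -/
def ContainmentProperty {V : Type*} (G : SimpleGraph V) (f : ℕ → ℕ) (r : ℕ) : Prop :=
  ∀ X0 : Set V, X0.Finite →
    ∃ W, IsStrategyBound f W ∧ (burnedSet G r W X0).Finite

/-- Polynomial containment property of degree `d` (fire reach one). -/
def PolyContainment {V : Type*} (G : SimpleGraph V) (d : ℕ) : Prop :=
  ∃ K : ℕ, 0 < K ∧ ContainmentProperty G (fun n => K * n ^ d) 1

/-- The constant containment property. -/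
def ConstantContainment {V : Type*} (G : SimpleGraph V) : Prop := PolyContainment G 0

/-- `D` is (the vertex set of) a connected component of `G \ K`. -/
def ComponentAvoiding {V : Type*} (G : SimpleGraph V) (K D : Set V) : Prop :=
  D.Nonempty ∧ D ⊆ Kᶜ ∧
  (∀ u ∈ D, ∀ v ∈ D, ∃ p : G.Walk u v, ∀ x ∈ p.support, x ∉ K) ∧
  (∀ u ∈ D, ∀ v : V, v ∉ K → (∃ p : G.Walk u v, ∀ x ∈ p.support, x ∉ K) → v ∈ D)

/-- A deep component of `G \ K`: not contained in any bounded neighborhood of `K`. -/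
def IsDeepComponent {V : Type*} (G : SimpleGraph V) (K D : Set V) : Prop :=
  ComponentAvoiding G K D ∧ ∀ r : ℕ, ¬ D ⊆ {v | ∃ k ∈ K, G.dist k v ≤ r}

/-- An unbounded component of `G \ K`. -/
def IsUnboundedComponent {V : Type*} (G : SimpleGraph V) (K D : Set V) : Prop :=
  ComponentAvoiding G K D ∧ ∀ (v : V) (r : ℕ), ¬ D ⊆ {u | G.dist v u ≤ r}

/-- Uniformly locally finite graph: vertex degrees are bounded. -/
def UnifLocFinite {V : Type*} (G : SimpleGraph V) : Prop :=
  ∃ M : ℕ, ∀ v : V, (G.neighborSet v).Finite ∧ (G.neighborSet v).ncard ≤ M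

/-- Locally finite graph. -/
def LocFinite {V : Type*} (G : SimpleGraph V) : Prop := ∀ v : V, (G.neighborSet v).Finite

/-- A `c`-quasi-isometry between two connected graphs (with their path-metrics). -/
def GraphQI {V V' : Type*} (c : ℝ) (G : SimpleGraph V) (H : SimpleGraph V') (φ : V → V') : Prop :=
  1 ≤ c ∧
  (∀ a b : V, (G.dist a b : ℝ) / c - c ≤ (H.dist (φ a) (φ b) : ℝ) ∧
    (H.dist (φ a) (φ b) : ℝ) ≤ c * (G.dist a b : ℝ) + c) ∧
  (∀ y : V', ∃ x : V, (H.dist (φ x) y : ℝ) ≤ c)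

/-- The Cayley graph of a group with respect to a set `S`. -/
def cayley (G : Type) [Group G] (S : Set G) : SimpleGraph G :=
  SimpleGraph.fromRel (fun a b => a⁻¹ * b ∈ S)

/-- `S` is a finite generating set. -/
def IsFiniteGenSet {G : Type} [Group G] (S : Set G) : Prop :=
  S.Finite ∧ Subgroup.closure S = ⊤

/-- The ball of radius `n` around the identity for the word metric w.r.t. `T`. -/
def wordBall {G : Type} [Group G] (T : Set G) (n : ℕ) : Set G :=
  {g | ∃ l : List G, (∀ x ∈ l, x ∈ T ∨ x⁻¹ ∈ T) ∧ l.length ≤ n ∧ l.prod = g}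

/-- The word metric w.r.t. `T`. -/
noncomputable def wordDist {G : Type} [Group G] (T : Set G) (x y : G) : ℕ :=
  sInf {n | x⁻¹ * y ∈ wordBall T n}

/-- `G` is an amalgamated product `A ∗_C B` with `C` a proper subgroup of both factors,
where `C` corresponds to the given subgroup. -/
def SplitsOverAmalgam (G : Type) [Group G] (C : Subgroup G) : Prop :=
  ∃ (Gi : Bool → Type) (_ : ∀ i, Group (Gi i)) (K : Type) (_ : Group K)
    (φ : ∀ i, K →* Gi i),
    (∀ i, Function.Injective (φ i)) ∧ (∀ i, ¬ Function.Surjective (φ i)) ∧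
    ∃ e : G ≃* Monoid.PushoutI φ,
      C = Subgroup.comap e.toMonoidHom (Monoid.PushoutI.base φ).range

/-- `G` is an HNN-extension over the given subgroup `C`. -/
def SplitsOverHNN (G : Type) [Group G] (C : Subgroup G) : Prop :=
  ∃ (H : Type) (_ : Group H) (A B : Subgroup H) (φ : A ≃* B)
    (e : G ≃* HNNExtension H A B φ),
    C = Subgroup.comap e.toMonoidHom
      (Subgroup.map (HNNExtension.of : H →* HNNExtension H A B φ) A)

/-- `G` splits over `C`: amalgamated product with `C` proper in both factors,
or HNN-extension over `C`. -/
def SplitsOver (G : Type) [Group G] (C : Subgroup G) : Prop :=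
  SplitsOverAmalgam G C ∨ SplitsOverHNN G C

/-- Amenability of a (discrete) group: existence of a left-invariant, finitely
additive probability measure defined on all subsets. -/
def IsAmenable (G : Type) [Group G] : Prop :=
  ∃ m : Set G → ℝ, (∀ A : Set G, 0 ≤ m A) ∧ m Set.univ = 1 ∧
    (∀ A B : Set G, Disjoint A B → m (A ∪ B) = m A + m B) ∧
    (∀ (g : G) (A : Set G), m ((g * ·) '' A) = m A)



section CayleyGraph

variable {G : Type} [Group G] {S : Set G}

theorem cayley_adj_iff {a b : G} :
    (cayley G S).Adj a b ↔ a ≠ b ∧ (a⁻¹ * b ∈ S ∨ b⁻¹ * a ∈ S) := by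
  simp [cayley, SimpleGraph.fromRel_adj]

/-- Left translation as an endomorphism of the Cayley graph. -/
def cayleyLeftMul (S : Set G) (g : G) : cayley G S →g cayley G S where
  toFun x := g * x
  map_rel' {a b} h := by
    rw [cayley_adj_iff] at h ⊢
    simpa [mul_assoc] using h

theorem cayley_connected (hS : Subgroup.closure S = ⊤) : (cayley G S).Connected := by
  have key : ∀ g : G, (cayley G S).Reachable 1 g := by
    intro g
    have hg : g ∈ Subgroup.closure S := hS ▸ Subgroup.mem_top g
    induction hg using Subgroup.closure_induction with
    | mem x hx =>
      by_cases h : 1 = x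
      · rw [← h]
      · exact SimpleGraph.Adj.reachable (cayley_adj_iff.2 ⟨h, Or.inl (by simpa using hx)⟩)
    | one => exact SimpleGraph.Reachable.refl _
    | mul x y _ _ hx hy =>
      have := hy.map (cayleyLeftMul S x)
      exact hx.trans (by simpa [cayleyLeftMul] using this)
    | inv x _ hx =>
      have := hx.map (cayleyLeftMul S x⁻¹)
      exact SimpleGraph.Reachable.symm (by simpa [cayleyLeftMul] using this)
  exact ⟨fun a b => (key a).symm.trans (key b)⟩

theorem cayley_dist_mul_left_le (hS : Subgroup.closure S = ⊤) (g a b : G) :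
    (cayley G S).dist (g * a) (g * b) ≤ (cayley G S).dist a b := by
  obtain ⟨p, hp⟩ := (cayley_connected hS).exists_walk_length_eq_dist a b
  rw [← hp, ← SimpleGraph.Walk.length_map (cayleyLeftMul S g) p]
  exact SimpleGraph.dist_le _

theorem cayley_dist_mul_left (hS : Subgroup.closure S = ⊤) (g a b : G) :
    (cayley G S).dist (g * a) (g * b) = (cayley G S).dist a b := by
  refine le_antisymm (cayley_dist_mul_left_le hS g a b) ?_
  simpa using cayley_dist_mul_left_le hS g⁻¹ (g * a) (g * b)

theorem cayley_dist_one_inv (hS : Subgroup.closure S = ⊤) (g : G) :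
    (cayley G S).dist 1 g⁻¹ = (cayley G S).dist 1 g := by
  rw [← cayley_dist_mul_left hS g 1 g⁻¹, mul_one, mul_inv_cancel, SimpleGraph.dist_comm]

theorem cayley_neighborSet_finite (hS : S.Finite) (a : G) :
    ((cayley G S).neighborSet a).Finite := by
  refine ((hS.union hS.inv).image (a * ·)).subset ?_
  intro b hb
  rw [SimpleGraph.mem_neighborSet, cayley_adj_iff] at hb
  refine ⟨a⁻¹ * b, ?_, by simp⟩
  rcases hb.2 with h | h
  · exact Or.inl h
  · exact Or.inr (by simpa using h)

theorem SimpleGraph.finite_setOf_walk_length_le {V : Type*} {Γ : SimpleGraph V}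
    (hΓ : ∀ v, (Γ.neighborSet v).Finite) (n : ℕ) (u : V) :
    {v | ∃ p : Γ.Walk u v, p.length ≤ n}.Finite := by
  induction n generalizing u with
  | zero =>
    refine (Set.finite_singleton u).subset ?_
    rintro v ⟨p, hp⟩
    exact (SimpleGraph.Walk.eq_of_length_eq_zero (Nat.le_zero.1 hp)).symm
  | succ n ih =>
    refine ((Set.finite_singleton u).union ((hΓ u).biUnion fun w _ => ih w)).subset ?_
    rintro v ⟨p, hp⟩
    cases p with
    | nil => exact Or.inl rfl
    | cons h q =>
      exact Or.inr (Set.mem_biUnion h ⟨q, by simpa using hp⟩)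

theorem cayley_ball_finite (hS : IsFiniteGenSet S) (u : G) (n : ℕ) :
    {v | (cayley G S).dist u v ≤ n}.Finite := by
  refine (SimpleGraph.finite_setOf_walk_length_le
    (fun v => cayley_neighborSet_finite hS.1 v) n u).subset ?_
  intro v hv
  obtain ⟨p, hp⟩ := (cayley_connected hS.2).exists_walk_length_eq_dist u v
  exact ⟨p, hp.le.trans hv⟩

end CayleyGraph

section Fire

/-- A fire of reach one that starts outside `U` never enters `U` if the inner vertex boundary of
`U` is protected at time one. -/
theorem burnedSet_subset_compl {V : Type*} (Γ : SimpleGraph V) (U X0 : Set V) (W : ℕ → Set V)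
    (hX0 : Disjoint X0 U) (hW : {v | v ∈ U ∧ ∃ w, w ∉ U ∧ Γ.Adj w v} ⊆ W 1) :
    burnedSet Γ 1 W X0 ⊆ Uᶜ := by
  have key : ∀ n, fireSet Γ 1 W X0 n ⊆ Uᶜ := by
    intro n
    induction n with
    | zero => exact hX0.subset_compl_right
    | succ n ih =>
      rintro v ⟨u, hu, p, hp, hav⟩ hvU
      have huU := ih hu
      cases p with
      | nil => exact huU hvU
      | cons h q =>
        have hq : q.length = 0 := by simpa using hp
        obtain rfl := SimpleGraph.Walk.eq_of_length_eq_zero hq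
        refine hav _ (SimpleGraph.Walk.end_mem_support _) ⟨?_, fun hv => ih hv hvU⟩
        exact Set.mem_biUnion (Finset.mem_coe.2 (Finset.mem_Icc.2 ⟨le_rfl, by omega⟩))
          (hW ⟨hvU, u, huU, h⟩)
  exact Set.iUnion_subset key

end Fire

/-- `V` is a subset with infinite complement that is almost invariant under left translations,
such that up to finitely many elements and inversion `G` is covered by finitely many right
translates of `V`. -/
structure IsAlmostInvariantHalf {P : Type} [Group P] (V F : Set P) : Prop where
  almost_invariant : ∀ s, {v | v ∈ V ∧ s * v ∉ V}.Finite
  infinite_compl : Vᶜ.Infinite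
  finite : F.Finite
  cover : ∀ g, g ∈ F ∨ ∃ x ∈ F, g * x ∈ V ∨ g⁻¹ * x ∈ V

namespace IsAlmostInvariantHalf

theorem preimage {P Q : Type} [Group P] [Group Q] {V F : Set Q} (h : IsAlmostInvariantHalf V F)
    (e : P ≃* Q) : IsAlmostInvariantHalf (e ⁻¹' V) (e ⁻¹' F) where
  almost_invariant s := by
    refine ((h.almost_invariant (e s)).preimage (f := e) e.injective.injOn).subset ?_
    rintro v ⟨h1, h2⟩
    exact ⟨h1, by simpa using h2⟩
  infinite_compl := by
    have := h.infinite_compl.preimage (f := e) (by simp [e.surjective.range_eq])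
    simpa using this
  finite := h.finite.preimage e.injective.injOn
  cover g := by
    rcases h.cover (e g) with h1 | ⟨x, hx, h1⟩
    · exact Or.inl h1
    · exact Or.inr ⟨e.symm x, by simpa using hx, by simpa using h1⟩

theorem of_closure {P : Type} [Group P] {V : Set P} {T : Set P} (hT : Subgroup.closure T = ⊤)
    (h : ∀ s ∈ T, {v | v ∈ V ∧ s * v ∉ V}.Finite ∧ {v | v ∈ V ∧ s⁻¹ * v ∉ V}.Finite) (s : P) :
    {v | v ∈ V ∧ s * v ∉ V}.Finite := by
  have hs : s ∈ Subgroup.closure T := hT ▸ Subgroup.mem_top s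
  suffices {v | v ∈ V ∧ s * v ∉ V}.Finite ∧ {v | v ∈ V ∧ s⁻¹ * v ∉ V}.Finite from this.1
  have mul_aux : ∀ x y : P, {v | v ∈ V ∧ x * v ∉ V}.Finite → {v | v ∈ V ∧ y * v ∉ V}.Finite →
      {v | v ∈ V ∧ (x * y) * v ∉ V}.Finite := by
    intro x y hx hy
    refine (hy.union (hx.preimage (f := (y * ·)) (mul_right_injective y).injOn)).subset ?_
    rintro v ⟨h1, h2⟩
    by_cases h3 : y * v ∈ V
    · exact Or.inr ⟨h3, by simpa [mul_assoc] using h2⟩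
    · exact Or.inl ⟨h1, h3⟩
  induction hs using Subgroup.closure_induction with
  | mem x hx => exact h x hx
  | one => constructor <;> simp
  | mul x y _ _ hx hy =>
    rw [mul_inv_rev]
    exact ⟨mul_aux _ _ hx.1 hy.1, mul_aux _ _ hy.2 hx.2⟩
  | inv x _ hx => exact ⟨hx.2, by simpa using hx.1⟩

variable {G : Type} [Group G] {S V F : Set G}

theorem inter_boundary_finite (h : IsAlmostInvariantHalf V F) (hS : S.Finite) :
    {v | v⁻¹ ∈ V ∧ ∃ w, w⁻¹ ∉ V ∧ (cayley G S).Adj w v}.Finite := by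
  have : ∀ s ∈ S ∪ S⁻¹, {v : G | v⁻¹ ∈ V ∧ s * v⁻¹ ∉ V}.Finite := fun s _ =>
    (h.almost_invariant s).preimage (f := fun v : G => v⁻¹) inv_injective.injOn
  refine ((hS.union hS.inv).biUnion this).subset ?_
  rintro v ⟨hv, w, hw, hadj⟩
  refine Set.mem_biUnion (x := w⁻¹ * v) ?_ ⟨hv, by simpa using hw⟩
  rcases (cayley_adj_iff.1 hadj).2 with h | h
  · exact Or.inl h
  · exact Or.inr (by simpa using h)

theorem exists_mul_notMem (h : IsAlmostInvariantHalf V F) {X : Set G} (hX : X.Finite) :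
    ∃ k, ∀ x ∈ X, x * k ∉ V := by
  have : (⋃ x ∈ X, {k | k ∉ V ∧ x * k ∈ V}).Finite := by
    refine hX.biUnion fun x _ => ?_
    refine ((h.almost_invariant x⁻¹).preimage (f := (x * ·)) (mul_right_injective x).injOn).subset ?_
    rintro v ⟨h1, h2⟩
    exact ⟨h2, by simpa using h1⟩
  obtain ⟨k, hk, hk'⟩ := (h.infinite_compl.sdiff this).nonempty
  refine ⟨k, fun x hx hxk => hk' (Set.mem_biUnion hx ⟨hk, hxk⟩)⟩

theorem nonempty (h : IsAlmostInvariantHalf V F) : V.Nonempty := by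
  obtain ⟨g, -, hg⟩ := (h.infinite_compl.sdiff h.finite).nonempty
  rcases h.cover g with h1 | ⟨x, -, h1 | h1⟩
  · exact absurd h1 hg
  · exact ⟨_, h1⟩
  · exact ⟨_, h1⟩

theorem growthEqFull (h : IsAlmostInvariantHalf V F) (hS : IsFiniteGenSet S) (k : G) (R : Set G)
    (hR : {v | v⁻¹ * k ∈ V} ⊆ R) : GrowthEqFull (cayley G S) R := by
  obtain ⟨v₀, hv₀⟩ := h.nonempty
  have hconn := cayley_connected hS.2
  set Γ := cayley G S with hΓ
  set u₀ : G := k * v₀⁻¹ with hu₀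
  have hu₀R : u₀ ∈ R := hR (by simpa [hu₀] using hv₀)
  obtain ⟨m, hm⟩ : ∃ m, ∀ x ∈ F, Γ.dist 1 (k * x⁻¹) ≤ m := by
    obtain ⟨m, hm⟩ := (h.finite.image fun x => Γ.dist 1 (k * x⁻¹)).bddAbove
    exact ⟨m, fun x hx => hm ⟨x, hx, rfl⟩⟩
  set K := m + 2 * Γ.dist 1 u₀ with hK
  have hfin : ∀ n, {v | v ∈ R ∧ ∃ a ∈ ({u₀} : Set G), Γ.dist a v ≤ n}.Finite := fun n =>
    (cayley_ball_finite hS u₀ n).subset (by rintro v ⟨-, a, rfl, hv⟩; exact hv)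
  have hmono : Monotone (graphGrowth Γ R {u₀}) := fun a b hab =>
    Set.ncard_le_ncard (by rintro v ⟨h1, x, h2, h3⟩; exact ⟨h1, x, h2, h3.trans hab⟩) (hfin b)
  refine ⟨u₀, hu₀R, ?_, ?_⟩
  · have main : ∀ n, graphGrowth Γ Set.univ {u₀} n ≤
        F.ncard + 2 * (F.ncard * graphGrowth Γ R {u₀} (n + K)) := by
      intro n
      set B : Set G := {v | v ∈ R ∧ ∃ a ∈ ({u₀} : Set G), Γ.dist a v ≤ n + K} with hB
      have hBfin : B.Finite := hfin _
      set D : Set G := (fun q : G × G => q.1 * k⁻¹ * q.2) '' (F ×ˢ B) with hD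
      have hDfin : D.Finite := (h.finite.prod hBfin).image _
      have hDcard : D.ncard ≤ F.ncard * B.ncard := by
        rw [← Set.ncard_prod]
        exact Set.ncard_image_le (h.finite.prod hBfin)
      have memD : ∀ g x, x ∈ F → Γ.dist 1 g ≤ n + Γ.dist 1 u₀ → g⁻¹ * x ∈ V → g ∈ D := by
        intro g x hx hg hgx
        refine ⟨(x, k * x⁻¹ * g), ⟨hx, hR ?_, u₀, rfl, ?_⟩, by simp [mul_assoc]⟩
        · simpa [mul_assoc] using hgx
        · have h1 : Γ.dist u₀ (k * x⁻¹ * g) ≤ Γ.dist u₀ 1 + Γ.dist 1 (k * x⁻¹ * g) :=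
            hconn.dist_triangle
          have h2 : Γ.dist 1 (k * x⁻¹ * g) ≤
              Γ.dist 1 (k * x⁻¹) + Γ.dist (k * x⁻¹) (k * x⁻¹ * g) := hconn.dist_triangle
          have h3 : Γ.dist (k * x⁻¹) (k * x⁻¹ * g) = Γ.dist 1 g := by
            have := cayley_dist_mul_left hS.2 (k * x⁻¹) 1 g
            rwa [mul_one] at this
          have h4 := hm x hx
          rw [SimpleGraph.dist_comm (u := u₀) (v := 1)] at h1
          change Γ.dist u₀ (k * x⁻¹ * g) ≤ n + K
          omega
      have hsub : {v | v ∈ Set.univ ∧ ∃ a ∈ ({u₀} : Set G), Γ.dist a v ≤ n} ⊆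
          F ∪ (D ∪ (fun v => v⁻¹) '' D) := by
        rintro g ⟨-, a, rfl, hg⟩
        have hg1 : Γ.dist 1 g ≤ n + Γ.dist 1 u₀ := by
          have : Γ.dist 1 g ≤ Γ.dist 1 u₀ + Γ.dist u₀ g := hconn.dist_triangle
          omega
        rcases h.cover g with h1 | ⟨x, hx, h1 | h1⟩
        · exact Or.inl h1
        · refine Or.inr (Or.inr ⟨g⁻¹, memD _ x hx ?_ (by simpa using h1), by simp⟩)
          rwa [cayley_dist_one_inv hS.2]
        · exact Or.inr (Or.inl (memD _ x hx hg1 h1))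
      calc graphGrowth Γ Set.univ {u₀} n ≤ (F ∪ (D ∪ (fun v => v⁻¹) '' D)).ncard :=
            Set.ncard_le_ncard hsub (h.finite.union (hDfin.union (hDfin.image _)))
        _ ≤ F.ncard + (D.ncard + ((fun v => v⁻¹) '' D).ncard) :=
            (Set.ncard_union_le _ _).trans (Nat.add_le_add_left (Set.ncard_union_le _ _) _)
        _ ≤ F.ncard + (D.ncard + D.ncard) :=
            Nat.add_le_add_left (Nat.add_le_add_left (Set.ncard_image_le hDfin) _) _
        _ ≤ F.ncard + 2 * (F.ncard * B.ncard) := by omega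
    refine ⟨2 * F.ncard + K + 1, by omega, fun n => (main n).trans ?_⟩
    have h1 : graphGrowth Γ R {u₀} (n + K) ≤
        graphGrowth Γ R {u₀} ((2 * F.ncard + K + 1) * n + (2 * F.ncard + K + 1)) := by
      apply hmono
      nlinarith
    nlinarith [Nat.zero_le (graphGrowth Γ R {u₀} (n + K))]
  · refine ⟨1, one_pos, fun n => ?_⟩
    have : graphGrowth Γ R {u₀} n ≤ graphGrowth Γ Set.univ {u₀} (1 * n + 1) := by
      refine Set.ncard_le_ncard ?_ ?_
      · rintro v ⟨-, a, h2, h3⟩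
        exact ⟨trivial, a, h2, by omega⟩
      · exact (cayley_ball_finite hS u₀ (1 * n + 1)).subset
          (by rintro v ⟨-, a, rfl, hv⟩; exact hv)
    omega

theorem finiteStepRetaining (h : IsAlmostInvariantHalf V F) (hS : IsFiniteGenSet S) :
    ∃ f : ℕ, FiniteStepRetainingProperty (cayley G S) (fun _ => f) := by
  set I : Set G := {v | v⁻¹ ∈ V ∧ ∃ w, w⁻¹ ∉ V ∧ (cayley G S).Adj w v} with hI
  have hIfin : I.Finite := h.inter_boundary_finite hS.1
  refine ⟨I.ncard, fun X0 hX0 => ?_⟩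
  obtain ⟨k, hk⟩ := h.exists_mul_notMem hX0.inv
  set U : Set G := {v | v⁻¹ * k ∈ V} with hU
  have hdisj : Disjoint X0 U :=
    Set.disjoint_left.2 fun x hx hxU => hk x⁻¹ (by simpa using hx) hxU
  set W : ℕ → Set G := fun n => if n = 1 then (k * ·) '' I else ∅ with hW
  have hburn : burnedSet (cayley G S) 1 W X0 ⊆ Uᶜ := by
    refine burnedSet_subset_compl _ U X0 W hdisj ?_
    rintro v ⟨hv, w, hw, hadj⟩
    simp only [hW, if_true]
    refine ⟨k⁻¹ * v, ⟨by simpa [hU] using hv, k⁻¹ * w, by simpa [hU] using hw, ?_⟩, by simp⟩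
    exact (cayleyLeftMul S k⁻¹).map_rel hadj
  refine ⟨W, ⟨fun n _ => ?_, h.growthEqFull hS k _ (Set.subset_compl_comm.1 hburn)⟩, 2, ?_⟩
  · by_cases hn : n = 1
    · simp only [hW, hn, if_true]
      exact ⟨hIfin.image _, Set.ncard_image_le hIfin⟩
    · simp [hW, hn]
  · intro n hn
    simp [hW, show n ≠ 1 by omega]

end IsAlmostInvariantHalf

section Amalgam

open Monoid PushoutI

variable {ι : Type} {Gi : ι → Type} [∀ i, Group (Gi i)] {K : Type} [Group K]
  {φ : ∀ i, K →* Gi i} {d : NormalWord.Transversal φ}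

/-- The index of the last letter of a normal word in an amalgamated product. -/
def Monoid.PushoutI.NormalWord.lastIdx (w : PushoutI.NormalWord d) : Option ι :=
  (w.toList.map Sigma.fst).getLast?

theorem Monoid.PushoutI.NormalWord.prod_mem_range_of_lastIdx_eq_none (w : PushoutI.NormalWord d)
    (h : w.lastIdx = none) : w.prod ∈ (base φ).range := by
  have h' : w.toList = [] := by simpa [lastIdx, List.getLast?_eq_none_iff] using h
  exact ⟨w.head, by simp [NormalWord.prod, CoprodI.Word.prod, h']⟩

theorem Monoid.PushoutI.NormalWord.exists_append (w : PushoutI.NormalWord d) {i : ι} {s : Gi i}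
    (hs : s ∈ d.set i) (hs1 : s ≠ 1) (hw : w.lastIdx ≠ some i) :
    ∃ w' : PushoutI.NormalWord d, w'.lastIdx = some i ∧ w'.prod = w.prod * of i s := by
  refine ⟨⟨⟨w.toList ++ [⟨i, s⟩], ?_, ?_⟩, w.head, ?_⟩, ?_, ?_⟩
  · intro l hl
    rcases List.mem_append.1 hl with hl | hl
    · exact w.ne_one l hl
    · obtain rfl := List.mem_singleton.1 hl
      exact hs1
  · rw [List.isChain_append]
    refine ⟨w.chain_ne, by simp, ?_⟩
    rintro x hx y hy hxy
    simp only [List.head?_cons, Option.mem_def, Option.some.injEq] at hy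
    subst hy
    apply hw
    simp only [lastIdx, List.getLast?_map]
    rw [Option.mem_def.1 hx]
    simp [hxy]
  · intro j g hg
    rcases List.mem_append.1 hg with hg | hg
    · exact w.normalized j g hg
    · obtain ⟨rfl, h⟩ := Sigma.mk.inj (List.mem_singleton.1 hg)
      rw [eq_of_heq h]
      exact hs
  · simp [lastIdx]
  · simp [NormalWord.prod, CoprodI.Word.prod, mul_assoc]

theorem closure_range_of [Nonempty ι] :
    Subgroup.closure {x : PushoutI φ | ∃ i g, of i g = x} = ⊤ := by
  rw [eq_top_iff]
  rintro x -
  induction x using PushoutI.induction_on with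
  | of i g => exact Subgroup.subset_closure ⟨i, g, rfl⟩
  | base h =>
    obtain ⟨i⟩ := ‹Nonempty ι›
    rw [← of_apply_eq_base φ i]
    exact Subgroup.subset_closure ⟨i, _, rfl⟩
  | mul x y hx hy => exact mul_mem hx hy

variable [DecidableEq ι] [∀ i, DecidableEq (Gi i)]

theorem Monoid.PushoutI.NormalWord.lastIdx_rcons {i : ι} (p : NormalWord.Pair d i) :
    (NormalWord.rcons i p).lastIdx = (p.tail.toList.map Sigma.fst).getLast? ∨
      p.tail.toList = [] ∧ (NormalWord.rcons i p).lastIdx = some i := by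
  simp only [lastIdx, NormalWord.rcons, CoprodI.Word.equivPair_symm, CoprodI.Word.rcons]
  split_ifs with h
  · exact Or.inl rfl
  · by_cases h' : p.tail.toList = []
    · right
      simp [CoprodI.Word.cons, h']
    · left
      simp [CoprodI.Word.cons, List.getLast?_cons, List.getLast?_eq_some_getLast h']

theorem Monoid.PushoutI.NormalWord.lastIdx_summand_smul {i : ι} (g : Gi i)
    (w : PushoutI.NormalWord d) :
    (g • w).lastIdx = w.lastIdx ∨ w.lastIdx = none ∨ (g • w).lastIdx = none := by
  rw [NormalWord.summand_smul_def']
  obtain ⟨p, rfl⟩ := (NormalWord.equivPair i).symm.surjective w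
  rw [Equiv.apply_symm_apply]
  have h1 := NormalWord.lastIdx_rcons p
  have h2 := NormalWord.lastIdx_rcons { p with head := g * p.head }
  change (NormalWord.rcons i { p with head := g * p.head }).lastIdx =
    (NormalWord.rcons i p).lastIdx ∨ (NormalWord.rcons i p).lastIdx = none ∨
    (NormalWord.rcons i { p with head := g * p.head }).lastIdx = none
  rcases h1 with h1 | ⟨h1, h1'⟩ <;> rcases h2 with h2 | ⟨h2, h2'⟩
  · exact Or.inl (h2.trans h1.symm)
  · exact Or.inr (Or.inl (by simpa [show p.tail.toList = [] from h2] using h1))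
  · exact Or.inr (Or.inr (by simpa [h1] using h2))
  · exact Or.inl (h2'.trans h1'.symm)

end Amalgam

theorem Set.infinite_of_injective_of_notMem_range {α : Type*} {s : Set α} {f : α → α} {a : α}
    (hf : Function.Injective f) (hs : Set.MapsTo f s s) (ha : a ∈ s) (h : ∀ x ∈ s, f x ≠ a) :
    s.Infinite := by
  intro hfin
  have himage : f '' s = s := Set.eq_of_subset_of_ncard_le hs.image_subset
    (Set.ncard_image_of_injective s hf).ge hfin
  obtain ⟨x, hx, hxa⟩ := himage.ge ha
  exact h x hx hxa

section Amalgam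

open Monoid PushoutI

variable {Gi : Bool → Type} [∀ i, Group (Gi i)] {K : Type} [Group K] {φ : ∀ i, K →* Gi i}

theorem exists_isAlmostInvariantHalf_pushoutI (hinj : ∀ i, Function.Injective (φ i))
    (hsurj : ∀ i, ¬ Function.Surjective (φ i)) (hfin : ((base φ).range : Set (PushoutI φ)).Finite) :
    ∃ V F : Set (PushoutI φ), IsAlmostInvariantHalf V F := by
  classical
  obtain ⟨d⟩ := NormalWord.transversal_nonempty φ hinj
  have hs : ∀ i, ∃ s ∈ d.set i, s ≠ 1 := by
    intro i
    by_contra! hcon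
    refine hsurj i fun g => ?_
    have h1 := hcon _ ((d.compl i).equiv g).2.2
    have h2 := (d.compl i).equiv_fst_mul_equiv_snd g
    rw [h1, mul_one] at h2
    rw [← h2]
    exact ((d.compl i).equiv g).1.2
  choose s hsd hs1 using hs
  set L : PushoutI φ → Option Bool := fun x => (x • (NormalWord.empty : NormalWord d)).lastIdx
    with hL
  have hL_none : ∀ x, L x = none → x ∈ (base φ).range := by
    intro x hx
    simpa using NormalWord.prod_mem_range_of_lastIdx_eq_none _ hx
  have hL_one : L 1 = none := by simp [hL, NormalWord.lastIdx]
  have hL_mul : ∀ x i, L x ≠ some i → L (x * of i (s i)) = some i := by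
    intro x i hx
    obtain ⟨w, hw, hw'⟩ := NormalWord.exists_append _ (hsd i) (hs1 i) hx
    rw [NormalWord.prod_smul, NormalWord.prod_empty, mul_one] at hw'
    rw [hL, ← hw']
    simpa [NormalWord.prod_smul_empty] using hw
  have hL_smul : ∀ i (g : Gi i) x, L (of i g * x) = L x ∨ L x = none ∨ L (of i g * x) = none := by
    intro i g x
    simp only [hL, mul_smul, NormalWord.of_smul_eq_smul]
    exact NormalWord.lastIdx_summand_smul _ _
  have hT : ∀ i (g : Gi i),
      {v | v ∈ {x | L x = some true} ∧ of i g * v ∉ {x | L x = some true}}.Finite := by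
    intro i g
    refine (hfin.preimage (f := (of i g * ·)) (mul_right_injective _).injOn).subset ?_
    rintro v ⟨h1, h2⟩
    simp only [Set.mem_ofPred_eq] at h1 h2
    apply hL_none
    rcases hL_smul i g v with h | h | h
    · exact absurd (h.trans h1) h2
    · simp [h] at h1
    · exact h
  refine ⟨{x | L x = some true}, {1, of true (s true)}, ?_, ?_, ?_, ?_⟩
  · refine IsAlmostInvariantHalf.of_closure closure_range_of ?_
    rintro _ ⟨i, g, rfl⟩
    exact ⟨hT i g, by rw [← map_inv]; exact hT i g⁻¹⟩
  · refine Set.infinite_of_injective_of_notMem_range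
      (f := fun x => x * of true (s true) * of false (s false)) (a := 1)
      ((mul_left_injective _).comp (mul_left_injective _)) ?_ (by simp [hL_one]) ?_
    · intro x hx
      have h1 := hL_mul x true hx
      have h2 := hL_mul _ false (show L (x * of true (s true)) ≠ some false by simp [h1])
      simp [h2]
    · intro x hx h
      have h1 := hL_mul x true hx
      have h2 := hL_mul _ false (show L (x * of true (s true)) ≠ some false by simp [h1])
      rw [h, hL_one] at h2
      simp at h2
  · simp
  · intro g
    by_cases hg : L g = some true
    · exact Or.inr ⟨1, by simp, Or.inl (by simpa using hg)⟩
    · exact Or.inr ⟨_, by simp, Or.inl (hL_mul g true hg)⟩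

end Amalgam

section HNN

open HNNExtension

variable {H : Type} [Group H] {A B : Subgroup H} {φ : A ≃* B}

theorem HNNExtension.closure_range_of_union_t :
    Subgroup.closure (Set.range (of : H → HNNExtension H A B φ) ∪ {t}) = ⊤ := by
  rw [eq_top_iff]
  rintro x -
  induction x using HNNExtension.induction_on with
  | of g => exact Subgroup.subset_closure (Or.inl ⟨g, rfl⟩)
  | t => exact Subgroup.subset_closure (Or.inr rfl)
  | mul x y hx hy => exact mul_mem hx hy
  | inv x hx => exact inv_mem hx

theorem HNNExtension.exists_eq_of_mul_t_zpow (hA : A = ⊤) (hB : B = ⊤)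
    (x : HNNExtension H A B φ) : ∃ (h : H) (n : ℤ), x = of h * t ^ n := by
  have hx : x ∈ Subgroup.closure (Set.range (of : H → HNNExtension H A B φ) ∪ {t}) := by
    rw [closure_range_of_union_t]
    exact Subgroup.mem_top x
  induction hx using Subgroup.closure_induction_left with
  | one => exact ⟨1, 0, by simp⟩
  | mul_left x hx y _ ih =>
    obtain ⟨h, n, rfl⟩ := ih
    rcases hx with ⟨g, rfl⟩ | rfl
    · exact ⟨g * h, n, by simp [mul_assoc]⟩
    · refine ⟨φ ⟨h, hA ▸ Subgroup.mem_top h⟩, 1 + n, ?_⟩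
      rw [zpow_add, zpow_one, ← mul_assoc, ← mul_assoc, ← t_mul_of]
  | inv_mul_cancel x hx y _ ih =>
    obtain ⟨h, n, rfl⟩ := ih
    rcases hx with ⟨g, rfl⟩ | rfl
    · exact ⟨g⁻¹ * h, n, by simp [mul_assoc]⟩
    · refine ⟨φ.symm ⟨h, hB ▸ Subgroup.mem_top h⟩, -1 + n, ?_⟩
      rw [zpow_add, zpow_neg_one, ← mul_assoc, ← mul_assoc, ← inv_t_mul_of]

theorem exists_isAlmostInvariantHalf_hnn_of_eq_top [Finite H] (hA : A = ⊤) (hB : B = ⊤) :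
    ∃ V F : Set (HNNExtension H A B φ), IsAlmostInvariantHalf V F := by
  set e : HNNExtension H A B φ →* Multiplicative ℤ :=
    HNNExtension.lift (1 : H →* Multiplicative ℤ) (Multiplicative.ofAdd 1) (by simp) with he
  set N : HNNExtension H A B φ → ℤ := fun x => (e x).toAdd with hN
  have hN_mul : ∀ x y, N (x * y) = N x + N y := fun x y => by simp [hN]
  have hN_inv : ∀ x, N x⁻¹ = - N x := fun x => by simp [hN]
  have hN_t : N t = 1 := by simp [hN, he]
  have hN_of : ∀ h n, N (of h * t ^ n) = n := fun h n => by simp [hN, he]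
  refine ⟨{x | N x < 0}, Set.range of, fun s => ?_, ?_, Set.finite_range _, fun g => ?_⟩
  · refine (((Set.finite_univ (α := H)).prod (Set.finite_Ico (- N s) 0)).image
      fun q => of q.1 * t ^ q.2).subset ?_
    rintro v ⟨h1, h2⟩
    obtain ⟨h, n, rfl⟩ := exists_eq_of_mul_t_zpow hA hB v
    simp only [Set.mem_ofPred_eq, hN_mul s, hN_of] at h1 h2
    exact ⟨(h, n), ⟨trivial, by constructor <;> simp only <;> omega⟩, rfl⟩
  · refine Set.infinite_of_injective_of_notMem_range (f := (· * t)) (a := 1)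
      (mul_left_injective _) ?_ (by simp [hN]) ?_
    · intro x hx
      simp only [Set.mem_compl_iff, Set.mem_ofPred_eq, hN_mul, hN_t] at hx ⊢
      omega
    · intro x hx h
      have h1 := hN_mul x t
      rw [h, hN_t] at h1
      have h2 : N 1 = 0 := by simp [hN]
      simp only [Set.mem_compl_iff, Set.mem_ofPred_eq] at hx
      omega
  · rcases lt_trichotomy (N g) 0 with h | h | h
    · exact Or.inr ⟨1, ⟨1, by simp⟩, Or.inl (by simpa using h)⟩
    · left
      obtain ⟨k, n, rfl⟩ := exists_eq_of_mul_t_zpow hA hB g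
      rw [hN_of] at h
      exact ⟨k, by simp [h]⟩
    · exact Or.inr ⟨1, ⟨1, by simp⟩, Or.inr (by simpa [hN_inv] using h)⟩

variable {d : NormalWord.TransversalPair H A B}

theorem HNNExtension.NormalWord.getLast?_unitsSMul (u : ℤˣ) (w : NormalWord d) :
    (NormalWord.unitsSMul φ u w).toList.getLast? = w.toList.getLast? ∨ w.toList = [] ∨
      ∃ x, w.toList = [(-u, x)] ∧ w.head ∈ toSubgroup A B u := by
  by_cases hc : NormalWord.Cancels u w
  · rw [NormalWord.unitsSMul, dif_pos hc]
    cases w using NormalWord.consRecOn with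
    | ofGroup => simp
    | cons g u' w h1 h2 _ =>
      obtain rfl : u' = -u := by simpa [NormalWord.Cancels] using hc.2
      by_cases hw : w.toList = []
      · exact Or.inr (Or.inr ⟨w.head, by simp [hw], hc.1⟩)
      · left
        simp [NormalWord.unitsSMulWithCancel, List.getLast?_cons,
          List.getLast?_eq_some_getLast hw]
  · rw [NormalWord.unitsSMul, dif_neg hc]
    by_cases hw : w.toList = []
    · exact Or.inr (Or.inl hw)
    · left
      simp [List.getLast?_cons, List.getLast?_eq_some_getLast hw]

theorem HNNExtension.NormalWord.eq_one_of_mem (hd : ∀ u, 1 ∈ d.set u) {u : ℤˣ} {g : H}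
    (hg : g ∈ d.set u) (hg' : g ∈ toSubgroup A B u) : g = 1 := by
  have := (d.compl u).injective (a₁ := (⟨g, hg'⟩, ⟨1, hd u⟩)) (a₂ := (⟨1, one_mem _⟩, ⟨g, hg⟩))
    (by simp)
  simpa using congrArg (fun q => (q.1 : H)) this

theorem HNNExtension.NormalWord.exists_append (hd : ∀ u, 1 ∈ d.set u) (w : NormalWord d) (u : ℤˣ)
    (hw : w.toList.getLast? ≠ some (-u, 1)) :
    ∃ w' : NormalWord d, w'.toList.getLast? = some (u, 1) ∧
      w'.prod φ = w.prod φ * t ^ (u : ℤ) := by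
  refine ⟨⟨⟨w.head, w.toList ++ [(u, 1)], ?_⟩, ?_⟩, by simp, ?_⟩
  · rw [List.isChain_append]
    refine ⟨w.chain, by simp, ?_⟩
    rintro ⟨v, g⟩ hx y hy hxy
    simp only [List.head?_cons, Option.mem_def, Option.some.injEq] at hy
    subst hy
    obtain rfl := eq_one_of_mem hd (w.mem_set v g (List.mem_of_mem_getLast? hx)) hxy
    by_contra hne
    have hv : v = -u := Int.units_ne_iff_eq_neg.1 hne
    exact hw (by rw [Option.mem_def.1 hx, hv])
  · intro v g hg
    rcases List.mem_append.1 hg with hg | hg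
    · exact w.mem_set v g hg
    · obtain ⟨rfl, rfl⟩ := Prod.mk.inj (List.mem_singleton.1 hg)
      exact hd _
  · simp [ReducedWord.prod, mul_assoc]

theorem HNNExtension.NormalWord.exists_mul_last (w : NormalWord d) {u : ℤˣ} {s : H}
    (hs : s ∈ d.set u) (hw : w.toList.getLast? = some (u, 1)) :
    ∃ w' : NormalWord d, w'.toList.getLast? = some (u, s) ∧ w'.prod φ = w.prod φ * of s := by
  obtain ⟨l, hl⟩ := List.getLast?_eq_some_iff.1 hw
  have hchain := w.chain
  rw [hl, List.isChain_append] at hchain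
  refine ⟨⟨⟨w.head, l ++ [(u, s)], ?_⟩, ?_⟩, by simp, ?_⟩
  · rw [List.isChain_append]
    refine ⟨hchain.1, by simp, ?_⟩
    rintro x hx y hy hxy
    simp only [List.head?_cons, Option.mem_def, Option.some.injEq] at hy
    subst hy
    exact hchain.2.2 x hx (u, 1) (by simp) hxy
  · intro v g hg
    rcases List.mem_append.1 hg with hg | hg
    · exact w.mem_set v g (by simp [hl, hg])
    · obtain ⟨rfl, rfl⟩ := Prod.mk.inj (List.mem_singleton.1 hg)
      exact hs
  · simp [ReducedWord.prod, hl, mul_assoc]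

theorem exists_isAlmostInvariantHalf_hnn_of_ne_top (hA : A ≠ ⊤) (hfin : (A : Set H).Finite) :
    ∃ V F : Set (HNNExtension H A B φ), IsAlmostInvariantHalf V F := by
  classical
  obtain ⟨d, hd⟩ : ∃ d : NormalWord.TransversalPair H A B, ∀ u, 1 ∈ d.set u := by
    choose T hT using fun u => (toSubgroup A B u).exists_isComplement_right 1
    exact ⟨⟨T, fun u => (hT u).1⟩, fun u => (hT u).2⟩
  obtain ⟨s, hs, hs1⟩ : ∃ s ∈ d.set 1, s ≠ 1 := by
    by_contra! hcon
    refine hA (eq_top_iff.2 fun g _ => ?_)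
    have h1 := hcon _ ((d.compl 1).equiv g).2.2
    have h2 := (d.compl 1).equiv_fst_mul_equiv_snd g
    rw [h1, mul_one] at h2
    rw [← h2]
    exact ((d.compl 1).equiv g).1.2
  set W : HNNExtension H A B φ → NormalWord d := fun x => x • NormalWord.empty with hW
  set L : HNNExtension H A B φ → Option (ℤˣ × H) := fun x => (W x).toList.getLast? with hL
  have hW_prod : ∀ x, (W x).prod φ = x := fun x => by simp [hW]
  have hW_inj : Function.Injective W := fun x y h => by rw [← hW_prod x, h, hW_prod]
  have hL_prod : ∀ w : NormalWord d, L (w.prod φ) = w.toList.getLast? := fun w => by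
    simp [hL, hW]
  have hL_one : L 1 = none := by simp [hL, hW]
  have hL_t : ∀ x (u : ℤˣ), L x ≠ some (-u, 1) → L (x * t ^ (u : ℤ)) = some (u, 1) := by
    intro x u hx
    obtain ⟨w, hw, hw'⟩ := NormalWord.exists_append (φ := φ) hd _ u hx
    rw [hW_prod] at hw'
    rw [← hw', hL_prod, hw]
  have hL_s : ∀ x, L x = some (1, 1) → L (x * of s) = some (1, s) := by
    intro x hx
    obtain ⟨w, hw, hw'⟩ := NormalWord.exists_mul_last (φ := φ) _ hs hx
    rw [hW_prod] at hw'
    rw [← hw', hL_prod, hw]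
  have hT : ∀ u : ℤˣ, {v | v ∈ {x | L x = some (-1, 1)} ∧
      t ^ (u : ℤ) * v ∉ {x | L x = some (-1, 1)}}.Finite := by
    intro u
    have hE : {v | (W v).toList = [(-1, 1)] ∧ (W v).head ∈ A}.Finite := by
      refine Set.Finite.of_injOn (f := fun v => (W v).head) (fun v hv => hv.2) ?_ hfin
      intro v hv v' hv' h
      exact hW_inj (NormalWord.ext h (hv.1.trans hv'.1.symm))
    refine hE.subset ?_
    rintro v ⟨h1, h2⟩
    simp only [Set.mem_ofPred_eq] at h1 h2
    have h3 : W (t ^ (u : ℤ) * v) = NormalWord.unitsSMul φ u (W v) := by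
      simp only [hW, mul_smul]
      rw [NormalWord.t_pow_smul_eq_unitsSMul]
    rcases NormalWord.getLast?_unitsSMul (φ := φ) u (W v) with h | h | ⟨x, h, h'⟩
    · exact absurd ((congrArg (fun w => w.toList.getLast?) h3).trans (h.trans h1)) h2
    · simp [hL, h] at h1
    · simp only [hL, h, List.getLast?_singleton, Option.some.injEq, Prod.mk.injEq] at h1
      obtain ⟨hu, rfl⟩ := h1
      obtain rfl : u = 1 := neg_injective hu
      exact ⟨h, h'⟩
  have hT_of : ∀ g : H, {v | v ∈ {x | L x = some (-1, 1)} ∧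
      of g * v ∉ {x | L x = some (-1, 1)}}.Finite := by
    intro g
    refine Set.finite_empty.subset ?_
    rintro v ⟨h1, h2⟩
    refine h2 ?_
    simpa [hL, hW, mul_smul, NormalWord.of_smul_eq_smul] using h1
  refine ⟨{x | L x = some (-1, 1)}, {1, t⁻¹, of s * t⁻¹}, ?_, ?_, by simp, ?_⟩
  · refine IsAlmostInvariantHalf.of_closure closure_range_of_union_t ?_
    rintro x (⟨g, rfl⟩ | rfl)
    · exact ⟨hT_of g, by rw [← map_inv]; exact hT_of g⁻¹⟩
    · exact ⟨by simpa using hT 1, by simpa using hT (-1)⟩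
  · refine Set.infinite_of_injective_of_notMem_range (f := (· * t)) (a := 1)
      (mul_left_injective _) ?_ (by simp [hL_one]) ?_
    · intro x hx
      have h1 : L (x * t) = some (1, 1) := by simpa using hL_t x 1 hx
      simp [h1]
    · intro x hx h
      have h1 : L (x * t) = some (1, 1) := by simpa using hL_t x 1 hx
      rw [h, hL_one] at h1
      simp at h1
  · intro g
    by_cases hg : L g = some (1, 1)
    · refine Or.inr ⟨of s * t⁻¹, by simp, Or.inl ?_⟩
      have h1 := hL_t (g * of s) (-1) (by simp [hL_s g hg, hs1])
      simpa [mul_assoc] using h1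
    · refine Or.inr ⟨t⁻¹, by simp, Or.inl ?_⟩
      have h1 := hL_t g (-1) (by simpa using hg)
      simpa using h1

theorem exists_isAlmostInvariantHalf_hnn (hfin : (A : Set H).Finite) :
    ∃ V F : Set (HNNExtension H A B φ), IsAlmostInvariantHalf V F := by
  by_cases hA : A = ⊤
  · have : Finite H := Set.finite_univ_iff.1 (by simpa [hA] using hfin)
    refine exists_isAlmostInvariantHalf_hnn_of_eq_top hA (Subgroup.eq_top_of_card_eq B ?_)
    rw [← Nat.card_congr φ.toEquiv, hA, Subgroup.card_top]
  · exact exists_isAlmostInvariantHalf_hnn_of_ne_top hA hfin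

end HNN

theorem stmt10 (G : Type) [Group G] (S : Set G) (hS : IsFiniteGenSet S)
    (C : Subgroup G) (hCfin : (C : Set G).Finite) (hsplit : SplitsOver G C) :
    ∃ f : ℕ, FiniteStepRetainingProperty (cayley G S) (fun _ => f) := by
  rcases hsplit with ⟨Gi, _, K, _, φ, hinj, hsurj, e, rfl⟩ | ⟨H, _, A, B, φ, e, rfl⟩
  · have hfin : ((Monoid.PushoutI.base φ).range : Set (Monoid.PushoutI φ)).Finite :=
      Set.Finite.of_preimage hCfin e.surjective
    obtain ⟨V, F, h⟩ := exists_isAlmostInvariantHalf_pushoutI hinj hsurj hfin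
    exact (h.preimage e).finiteStepRetaining hS
  · have hfin : (Subgroup.map (HNNExtension.of : H →* HNNExtension H A B φ) A :
        Set (HNNExtension H A B φ)).Finite := Set.Finite.of_preimage hCfin e.surjective
    have hA : (A : Set H).Finite :=
      Set.Finite.of_finite_image hfin (HNNExtension.of_injective φ).injOn
    obtain ⟨V, F, h⟩ := exists_isAlmostInvariantHalf_hnn (φ := φ) hA
    exact (h.preimage e).finiteStepRetaining hS
end

section
/- Let G be a finitely generated group with the finite-step retaining property (degree zero). Then G has the constant containment property or G has infinitely many ends. -/
open CategoryTheory in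
/-- In a graph with finitely many ends, all ends are separated by some finite set `F`: an infinite
component outside a larger finite set is determined by the component of `Fᶜ` containing it. -/
lemma exists_finset_hom_injective {V : Type} (G : SimpleGraph V) [G.LocallyFinite]
    (hG : G.Preconnected) [Infinite V] (hfin : G.end.Finite) :
    ∃ F : Finset V, ∀ (K : Finset V) (h : F ⊆ K) (C C' : G.ComponentCompl K),
      C.supp.Infinite → C'.supp.Infinite → C.hom h = C'.hom h → C = C' := by
  classical
  have : Fact G.Preconnected := ⟨hG⟩
  have hML : G.componentComplFunctor.IsMittagLeffler :=
    G.componentComplFunctor.isMittagLeffler_of_exists_finite_range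
      fun j => ⟨j, 𝟙 j, Set.toFinite _⟩
  have : ∀ j, Nonempty (G.componentComplFunctor.toEventualRanges.obj j) :=
    G.componentComplFunctor.toEventualRanges_nonempty hML
  have : Finite G.componentComplFunctor.sections := hfin.to_subtype
  have : Finite G.componentComplFunctor.toEventualRanges.sections :=
    Finite.of_equiv _ G.componentComplFunctor.toEventualRangesSectionsEquiv.symm
  obtain ⟨j, hj⟩ := G.componentComplFunctor.toEventualRanges.eventually_injective
    (G.componentComplFunctor.surjective_toEventualRanges hML)
  refine ⟨j.unop, fun K h C C' hC hC' e => ?_⟩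
  have hC₁ := (SimpleGraph.infinite_iff_in_eventualRange G (K := Opposite.op K) C).1 hC
  have hC₂ := (SimpleGraph.infinite_iff_in_eventualRange G (K := Opposite.op K) C').1 hC'
  have := @hj (Opposite.op K) (opHomOfLE h) ⟨C, hC₁⟩ ⟨C', hC₂⟩ (Subtype.ext e)
  exact congrArg Subtype.val this

/-- A set that is not split by adjacency: the only nonempty subset of `C` closed under adjacency
inside `C` is `C` itself. -/
def IsAdjConnected {V : Type*} (G : SimpleGraph V) (C : Set V) : Prop :=
  ∀ A : Set V, (C ∩ A).Nonempty → (∀ c ∈ C ∩ A, ∀ d ∈ C, G.Adj c d → d ∈ A) → C ⊆ A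

/-- `A` is a union of components of the complement of `K`. -/
def IsClosedOff {V : Type*} (G : SimpleGraph V) (K A : Set V) : Prop :=
  Disjoint A K ∧ ∀ c ∈ A, ∀ d ∉ K, G.Adj c d → d ∈ A

lemma isAdjConnected_of_induce {V : Type*} {G : SimpleGraph V} {C : Set V}
    (h : (G.induce C).Preconnected) : IsAdjConnected G C := by
  rintro A ⟨c, hc, hcA⟩ hA d hd
  obtain ⟨p⟩ := h ⟨c, hc⟩ ⟨d, hd⟩
  have key : ∀ {u v : C}, (G.induce C).Walk u v → (u : V) ∈ A → (v : V) ∈ A := by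
    intro u v p
    induction p with
    | nil => exact id
    | cons e _ ih => exact fun hu => ih (hA _ ⟨Subtype.prop _, hu⟩ _ (Subtype.prop _) e)
  exact key p hcA

lemma isAdjConnected_componentCompl {V : Type*} {G : SimpleGraph V} {K : Set V}
    (C : G.ComponentCompl K) : IsAdjConnected G (C : Set V) := by
  rintro A ⟨c, ⟨hcK, hc⟩, hcA⟩ hA d ⟨hdK, hd⟩
  obtain ⟨p⟩ := SimpleGraph.ConnectedComponent.exact (hc.trans hd.symm)
  have key : ∀ {u v : (Kᶜ : Set V)}, (G.induce Kᶜ).Walk u v →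
      (u : V) ∈ C → (u : V) ∈ A → (v : V) ∈ A := by
    intro u v p
    induction p with
    | nil => exact fun _ => id
    | @cons u w v e _ ih =>
      intro huC hu
      have hwC : (w : V) ∈ C := SimpleGraph.ComponentCompl.mem_of_adj _ _ huC w.2 e
      exact ih hwC (hA _ ⟨huC, hu⟩ _ hwC e)
  exact key p ⟨hcK, hc⟩ hcA

lemma isClosedOff_componentCompl {V : Type*} {G : SimpleGraph V} {K : Set V}
    (C : G.ComponentCompl K) : IsClosedOff G K (C : Set V) :=
  ⟨C.disjoint_right.symm,
    fun c hc d hd e => SimpleGraph.ComponentCompl.mem_of_adj c d hc hd e⟩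

lemma IsAdjConnected.subset_of_isClosedOff {V : Type*} {G : SimpleGraph V} {C K A : Set V}
    (hC : IsAdjConnected G C) (hA : IsClosedOff G K A) (hCK : Disjoint C K)
    (hne : (C ∩ A).Nonempty) : C ⊆ A :=
  hC A hne fun c hc d hd e => hA.2 c hc.2 d (Set.disjoint_left.1 hCK hd) e

/-- An infinite union of components of the complement of a finite set contains an infinite
component. -/
lemma IsClosedOff.exists_componentCompl {V : Type} {G : SimpleGraph V} [G.LocallyFinite]
    (hG : G.Preconnected) {K : Finset V} {A : Set V} (hA : IsClosedOff G K A)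
    (hinf : A.Infinite) : ∃ C : G.ComponentCompl K, C.supp.Infinite ∧ (C : Set V) ⊆ A := by
  have : Fact G.Preconnected := ⟨hG⟩
  have hcov : A ⊆ ⋃ C : G.ComponentCompl K, A ∩ (C : Set V) := fun a ha => by
    have haK : a ∉ (K : Set V) := Set.disjoint_left.1 hA.1 ha
    exact Set.mem_iUnion.2 ⟨G.componentComplMk haK, ha, G.componentComplMk_mem haK⟩
  obtain ⟨C, hC⟩ : ∃ C : G.ComponentCompl K, (A ∩ (C : Set V)).Infinite := by
    by_contra! hno
    exact hinf ((Set.finite_iUnion hno).subset hcov)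
  refine ⟨C, hC.mono Set.inter_subset_right, ?_⟩
  obtain ⟨c, hcA, hc⟩ := hC.nonempty
  exact (isAdjConnected_componentCompl C).subset_of_isClosedOff hA C.disjoint_right.symm
    ⟨c, hc, hcA⟩

/-- `F` separates all ends of `G`: no component of `Fᶜ` can be cut further into two infinite pieces
by a finite set. -/
def SeparatesEnds {V : Type*} (G : SimpleGraph V) (F : Finset V) : Prop :=
  ∀ K : Finset V, F ⊆ K → ∀ (D : G.ComponentCompl F) (A A' : Set V),
    A ⊆ (D : Set V) → A' ⊆ (D : Set V) → Disjoint A A' →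
    IsClosedOff G K A → IsClosedOff G K A' → A.Finite ∨ A'.Finite

lemma exists_separatesEnds {V : Type} (G : SimpleGraph V) [G.LocallyFinite]
    (hG : G.Preconnected) [Infinite V] (hfin : G.end.Finite) (v : V) :
    ∃ F : Finset V, v ∈ F ∧ IsAdjConnected G F ∧ SeparatesEnds G F := by
  classical
  obtain ⟨F₀, hF₀⟩ := exists_finset_hom_injective G hG hfin
  obtain ⟨F, hF, hFc⟩ := SimpleGraph.extend_finset_to_connected hG (Finset.insert_nonempty v F₀)
  have hF₀F : F₀ ⊆ F := (Finset.subset_insert v F₀).trans hF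
  refine ⟨F, hF (Finset.mem_insert_self _ _), isAdjConnected_of_induce hFc.preconnected, ?_⟩
  intro K hFK D A A' hAD hAD' hdis hA hA'
  by_contra! hinf
  obtain ⟨C, hC, hCA⟩ := hA.exists_componentCompl hG hinf.1
  obtain ⟨C', hC', hCA'⟩ := hA'.exists_componentCompl hG hinf.2
  have e : C.hom hFK = D := (C.hom_eq_iff_le hFK D).2 (hCA.trans hAD)
  have e' : C'.hom hFK = D := (C'.hom_eq_iff_le hFK D).2 (hCA'.trans hAD')
  have heq : C = C' := by
    refine hF₀ K (hF₀F.trans hFK) C C' hC hC' ?_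
    rw [C.hom_trans hFK hF₀F, C'.hom_trans hFK hF₀F, e, e']
  subst heq
  obtain ⟨c, hc⟩ := C.nonempty
  exact Set.disjoint_left.1 hdis (hCA hc) (hCA' hc)

/-- If the complement of a finite set `F` separating the ends has at most one infinite component,
then any set with finite vertex boundary is finite or cofinite. -/
lemma SeparatesEnds.finite_or_finite_compl {V : Type} {G : SimpleGraph V} [G.LocallyFinite]
    (hG : G.Preconnected) {F : Finset V} (hF : SeparatesEnds G F)
    (hone : ∀ D D' : G.ComponentCompl F, D.supp.Infinite → D'.supp.Infinite → D = D')
    {B P : Set V} (hP : P.Finite) (hB : ∀ c ∈ B, ∀ d ∉ B, G.Adj c d → d ∈ P) :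
    B.Finite ∨ Bᶜ.Finite := by
  classical
  by_contra! hinf
  let Q : Set V := P ∪ ⋃ p ∈ P, G.neighborSet p
  have hQ : Q.Finite := hP.union (hP.biUnion fun p _ => Set.toFinite _)
  let K : Finset V := F ∪ hQ.toFinset
  have hFK : F ⊆ K := Finset.subset_union_left
  have hPK : ∀ x ∈ P, x ∈ K := fun x hx =>
    Finset.mem_union_right _ (hQ.mem_toFinset.2 (Or.inl hx))
  have hA : IsClosedOff G K (B \ K) := by
    refine ⟨Set.disjoint_sdiff_left, fun c hc d hd e => ⟨?_, hd⟩⟩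
    by_contra hdB
    exact hd (hPK d (hB c hc.1 d hdB e))
  have hA' : IsClosedOff G K (Bᶜ \ K) := by
    refine ⟨Set.disjoint_sdiff_left, fun c hc d hd e => ⟨fun hdB => ?_, hd⟩⟩
    exact hc.2 (hPK c (hB d hdB c hc.1 e.symm))
  obtain ⟨C, hC, hCA⟩ := hA.exists_componentCompl hG (hinf.1.sdiff K.finite_toSet)
  obtain ⟨C', hC', hCA'⟩ := hA'.exists_componentCompl hG (hinf.2.sdiff K.finite_toSet)
  have heq : C.hom hFK = C'.hom hFK :=
    hone _ _ (C.hom_infinite hFK hC) (C'.hom_infinite hFK hC')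
  rcases hF K hFK (C.hom hFK) C C' (C.subset_hom hFK) (heq ▸ C'.subset_hom hFK)
    (Set.disjoint_of_subset (hCA.trans Set.sdiff_subset) (hCA'.trans Set.sdiff_subset)
      disjoint_compl_right)
    (isClosedOff_componentCompl C) (isClosedOff_componentCompl C') with h | h
  · exact hC h
  · exact hC' h

lemma mem_protectedUpTo {V : Type*} {W : ℕ → Set V} {n : ℕ} {v : V} :
    v ∈ protectedUpTo W n ↔ ∃ i, 1 ≤ i ∧ i ≤ n ∧ v ∈ W i := by
  simp [protectedUpTo, and_assoc]

/-- A fire cannot leave a set whose outer boundary is protected at the first step. -/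
lemma burnedSet_subset {V : Type*} {G : SimpleGraph V} {P Z X0 : Set V} (hX : X0 ⊆ Z)
    (hZ : ∀ c ∈ Z, ∀ d ∉ P, G.Adj c d → d ∈ Z) :
    burnedSet G 1 (fun n => if n = 1 then P else ∅) X0 ⊆ Z := by
  refine Set.iUnion_subset fun n => ?_
  induction n with
  | zero => exact hX
  | succ n ih =>
    rintro v ⟨u, hu, p, hp, hav⟩
    by_cases hv : v ∈ fireSet G 1 (fun n => if n = 1 then P else ∅) X0 n
    · exact ih hv
    have hvP : v ∉ P := fun hvP =>
      hav v p.end_mem_support ⟨mem_protectedUpTo.2 ⟨1, le_rfl, by omega, by simpa using hvP⟩, hv⟩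
    rcases Nat.le_one_iff_eq_zero_or_eq_one.1 hp with h | h
    · exact SimpleGraph.Walk.eq_of_length_eq_zero h ▸ ih hu
    · exact hZ u (ih hu) v hvP (SimpleGraph.Walk.adj_of_length_eq_one h)

/-- The outer boundary of the burned set is protected. -/
lemma mem_protectedUpTo_of_adj_burnedSet {V : Type*} {G : SimpleGraph V} {W : ℕ → Set V}
    {X0 : Set V} {N : ℕ} (hN : ∀ n, N ≤ n → W n = ∅) {c d : V} (hc : c ∈ burnedSet G 1 W X0)
    (hd : d ∉ burnedSet G 1 W X0) (e : G.Adj c d) : d ∈ protectedUpTo W N := by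
  obtain ⟨n, hn⟩ := Set.mem_iUnion.1 hc
  by_contra hdP
  refine hd (Set.mem_iUnion.2 ⟨n + 1, c, hn, e.toWalk, by simp, fun x hx hxP => ?_⟩)
  simp only [SimpleGraph.Walk.support_cons, SimpleGraph.Walk.support_nil, List.mem_cons,
    List.not_mem_nil, or_false] at hx
  rcases hx with rfl | rfl
  · exact hxP.2 hn
  · obtain ⟨i, hi, -, hiW⟩ := mem_protectedUpTo.1 hxP.1
    refine hdP (mem_protectedUpTo.2 ⟨i, hi, ?_, hiW⟩)
    by_contra! hNi
    simp [hN i hNi.le] at hiW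

lemma finite_walk_ball {V : Type*} (G : SimpleGraph V) [G.LocallyFinite] (n : ℕ) (u : V) :
    {v | ∃ p : G.Walk u v, p.length ≤ n}.Finite := by
  induction n generalizing u with
  | zero =>
    refine (Set.finite_singleton u).subset ?_
    rintro v ⟨p, hp⟩
    exact (SimpleGraph.Walk.eq_of_length_eq_zero (Nat.le_zero.1 hp)).symm
  | succ n ih =>
    refine ((Set.finite_singleton u).union
      ((G.neighborSet u).toFinite.biUnion fun w _ => ih w)).subset ?_
    rintro v ⟨p, hp⟩
    cases p with
    | nil => exact Or.inl rfl
    | cons e q =>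
      refine Or.inr (Set.mem_biUnion e ⟨q, ?_⟩)
      simpa using hp

/-- In an infinite graph, a set with full growth is infinite. -/
lemma GrowthEqFull.infinite {V : Type*} [Infinite V] {G : SimpleGraph V} [G.LocallyFinite]
    (hG : G.Preconnected) {U : Set V} (h : GrowthEqFull G U) : U.Infinite := by
  intro hU
  obtain ⟨u, -, ⟨C, -, hC⟩, -⟩ := h
  obtain ⟨T, hT⟩ := Infinite.exists_subset_card_eq V (C * U.ncard + C + 1)
  let n := T.sup (G.dist u)
  have hball : {v | v ∈ (Set.univ : Set V) ∧ ∃ a ∈ ({u} : Set V), G.dist a v ≤ n}.Finite := by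
    refine (finite_walk_ball G n u).subset ?_
    rintro v ⟨-, a, rfl, hv⟩
    obtain ⟨p, hp⟩ := (hG a v).exists_walk_length_eq_dist
    exact ⟨p, hp.trans_le hv⟩
  have h₁ : T.card ≤ graphGrowth G Set.univ {u} n := by
    rw [← Set.ncard_coe_finset]
    exact Set.ncard_le_ncard
      (fun t ht => ⟨trivial, u, rfl, Finset.le_sup (f := G.dist u) ht⟩) hball
  have h₂ : graphGrowth G U {u} (C * n + C) ≤ U.ncard :=
    Set.ncard_le_ncard (fun v hv => hv.1) hU
  have h₃ := hC n
  have h₄ := Nat.mul_le_mul_left C h₂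
  omega

lemma cayley_adj_mul_left {G : Type} [Group G] {S : Set G} (x a b : G) :
    (cayley G S).Adj (x * a) (x * b) ↔ (cayley G S).Adj a b := by
  simp [cayley, mul_assoc]

lemma cayley_preconnected {G : Type} [Group G] {S : Set G} (hS : Subgroup.closure S = ⊤) :
    (cayley G S).Preconnected := by
  have key : ∀ g : G, ∀ a : G, (cayley G S).Reachable a (a * g) := by
    intro g
    have hg : g ∈ Subgroup.closure S := hS ▸ Subgroup.mem_top g
    induction hg using Subgroup.closure_induction with
    | mem s hs =>
      intro a
      by_cases h : a = a * s
      · rw [← h]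
      · exact SimpleGraph.Adj.reachable
          ((SimpleGraph.fromRel_adj _ _ _).2 ⟨h, Or.inl (by simpa using hs)⟩)
    | one => exact fun a => by simp
    | mul x y _ _ hx hy => exact fun a => by simpa [mul_assoc] using (hx a).trans (hy (a * x))
    | inv x _ hx => exact fun a => by simpa using (hx (a * x⁻¹)).symm
  intro a b
  simpa using key (a⁻¹ * b) a

lemma finite_neighborSet_cayley {G : Type} [Group G] {S : Set G} (hS : S.Finite) (a : G) :
    ((cayley G S).neighborSet a).Finite := by
  refine ((hS.image (a * ·)).union (hS.image fun s => a * s⁻¹)).subset fun b hb => ?_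
  rcases ((SimpleGraph.fromRel_adj (fun a b : G => a⁻¹ * b ∈ S) a b).1 hb).2 with h | h
  · exact Or.inl ⟨_, h, by simp⟩
  · exact Or.inr ⟨_, h, by simp⟩

lemma IsAdjConnected.mul_left {G : Type} [Group G] {S : Set G} {C : Set G}
    (hC : IsAdjConnected (cayley G S) C) (x : G) :
    IsAdjConnected (cayley G S) ((x * ·) '' C) := by
  rintro A ⟨_, ⟨c, hc, rfl⟩, hcA⟩ hA _ ⟨d, hd, rfl⟩
  refine hC ((x * ·) ⁻¹' A) ⟨c, hc, hcA⟩ (fun c hc d hd e => ?_) hd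
  exact hA _ ⟨⟨c, hc.1, rfl⟩, hc.2⟩ _ ⟨d, hd, rfl⟩ ((cayley_adj_mul_left x c d).2 e)

lemma IsClosedOff.mul_left {G : Type} [Group G] {S : Set G} {K A : Set G}
    (hA : IsClosedOff (cayley G S) K A) (x : G) :
    IsClosedOff (cayley G S) ((x * ·) '' K) ((x * ·) '' A) := by
  refine ⟨(Set.disjoint_image_iff (mul_right_injective x)).2 hA.1, ?_⟩
  rintro _ ⟨c, hc, rfl⟩ d hd e
  refine ⟨x⁻¹ * d, hA.2 c hc _ (fun h => hd ⟨_, h, by simp⟩) ?_, by simp⟩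
  rw [← cayley_adj_mul_left x]
  simpa using e

/-- If `F` has two infinite complementary components, a translate of `F` lying far out in a
component `D` cuts off from any given connected finite set `Y ⊇ F` an infinite part of `D`. -/
lemma exists_infinite_isClosedOff_translate {G : Type} [Group G] {S : Set G}
    (hG : (cayley G S).Preconnected) {F : Finset G} (h1 : 1 ∈ F)
    (hFc : IsAdjConnected (cayley G S) F) {D₁ D₂ : (cayley G S).ComponentCompl F}
    (hD₁ : D₁.supp.Infinite) (hD₂ : D₂.supp.Infinite) (hne : D₁ ≠ D₂) {Y : Set G}
    (hYc : IsAdjConnected (cayley G S) Y) (hFY : (F : Set G) ⊆ Y)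
    {D : (cayley G S).ComponentCompl F} {x : G} (hx : x ∈ D)
    (hxY : Disjoint Y ((x * ·) '' (F : Set G))) :
    (x * ·) '' (F : Set G) ⊆ D ∧ ∃ A : Set G, A.Infinite ∧ A ⊆ D ∧ Disjoint A Y ∧
      IsClosedOff (cayley G S) ((x * ·) '' (F : Set G)) A := by
  have hxFD : (x * ·) '' (F : Set G) ⊆ D :=
    (hFc.mul_left x).subset_of_isClosedOff (isClosedOff_componentCompl D)
      (Set.disjoint_of_subset_left hFY hxY).symm ⟨x, ⟨1, h1, by simp⟩, hx⟩
  refine ⟨hxFD, ?_⟩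
  obtain ⟨E, hE, hEY⟩ : ∃ E : (cayley G S).ComponentCompl F, E.supp.Infinite ∧
      Disjoint ((x * ·) '' (E : Set G)) Y := by
    by_cases h : Disjoint ((x * ·) '' (D₁ : Set G)) Y
    · exact ⟨D₁, hD₁, h⟩
    · refine ⟨D₂, hD₂, ?_⟩
      obtain ⟨y, hyD, hyY⟩ := Set.not_disjoint_iff.1 h
      have hsub := hYc.subset_of_isClosedOff ((isClosedOff_componentCompl D₁).mul_left x) hxY
        ⟨y, hyY, hyD⟩
      exact Set.disjoint_of_subset_right hsub
        ((Set.disjoint_image_iff (mul_right_injective x)).2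
          (SimpleGraph.ComponentCompl.pairwise_disjoint hne.symm))
  refine ⟨(x * ·) '' (E : Set G), hE.image (mul_right_injective x).injOn, ?_, hEY,
    (isClosedOff_componentCompl E).mul_left x⟩
  have hEF := Set.disjoint_of_subset_right hFY hEY
  refine ((isAdjConnected_componentCompl E).mul_left x).subset_of_isClosedOff
    (isClosedOff_componentCompl D) hEF ?_
  obtain ⟨⟨v, k⟩, hv, hk, e⟩ := E.exists_adj_boundary_pair hG ⟨1, h1⟩
  exact ⟨x * v, ⟨v, hv, rfl⟩, SimpleGraph.ComponentCompl.mem_of_adj (x * k) (x * v)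
    (hxFD ⟨k, hk, rfl⟩) (Set.disjoint_left.1 hEF ⟨v, hv, rfl⟩)
    ((cayley_adj_mul_left x k v).2 e.symm)⟩

/-- A Cayley graph with finitely many, but at least two, ends has constant containment. -/
lemma constantContainment_of_separatesEnds {G : Type} [Group G] {S : Set G}
    [(cayley G S).LocallyFinite] (hG : (cayley G S).Preconnected) {F : Finset G} (h1 : 1 ∈ F)
    (hFc : IsAdjConnected (cayley G S) F) (hF : SeparatesEnds (cayley G S) F)
    {D₁ D₂ : (cayley G S).ComponentCompl F}
    (hD₁ : D₁.supp.Infinite) (hD₂ : D₂.supp.Infinite) (hne : D₁ ≠ D₂) :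
    ConstantContainment (cayley G S) := by
  classical
  have : Fact (cayley G S).Preconnected := ⟨hG⟩
  let ι := {D : (cayley G S).ComponentCompl F // D.supp.Infinite}
  have : Fintype ι := Fintype.ofFinite ι
  refine ⟨Fintype.card ι * F.card + 1, Nat.succ_pos _, fun X0 hX0 => ?_⟩
  obtain ⟨Y, hY, hYc⟩ := SimpleGraph.extend_finset_to_connected hG (t := F ∪ hX0.toFinset)
    ⟨1, Finset.mem_union_left _ h1⟩
  have hFY : (F : Set G) ⊆ Y := Finset.coe_subset.2 (Finset.subset_union_left.trans hY)
  have hXY : X0 ⊆ Y := fun v hv => hY (Finset.mem_union_right _ (hX0.mem_toFinset.2 hv))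
  have hx : ∀ D : ι, ∃ x ∈ D.1, Disjoint (Y : Set G) ((x * ·) '' (F : Set G)) := by
    intro D
    obtain ⟨x, hxD, hx⟩ :=
      (D.2.sdiff (Finset.image₂ (fun y f => y * f⁻¹) Y F).finite_toSet).nonempty
    refine ⟨x, hxD, Set.disjoint_left.2 ?_⟩
    rintro y hy ⟨f, hf, rfl⟩
    exact hx (Finset.mem_coe.2 (Finset.mem_image₂.2 ⟨_, hy, f, hf, by simp⟩))
  choose x hxD hxY using hx
  have hA := fun D : ι => exists_infinite_isClosedOff_translate hG h1 hFc hD₁ hD₂ hne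
    (isAdjConnected_of_induce hYc.preconnected) hFY (hxD D) (hxY D)
  choose hxFD A hAinf hAD hAY hAcl using hA
  let P : Finset G := Finset.univ.biUnion fun D : ι => F.image (x D * ·)
  have hP : ∀ v, v ∈ P ↔ ∃ D : ι, v ∈ (x D * ·) '' (F : Set G) := by
    intro v
    simp [P]
  have hPcard : P.card ≤ Fintype.card ι * F.card :=
    Finset.card_biUnion_le_card_mul _ _ _ fun D _ => Finset.card_image_le
  let Z : Set G := {z | z ∉ P ∧ ∀ D, z ∉ A D}
  have hXZ : X0 ⊆ Z := by
    refine fun v hv => ⟨fun hvP => ?_, fun D hvA => Set.disjoint_left.1 (hAY D) hvA (hXY hv)⟩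
    obtain ⟨D, hD⟩ := (hP v).1 hvP
    exact Set.disjoint_left.1 (hxY D) (hXY hv) hD
  have hZ : ∀ c ∈ Z, ∀ d ∉ (P : Set G), (cayley G S).Adj c d → d ∈ Z := by
    refine fun c hc d hd e => ⟨hd, fun D hdA => hc.2 D ?_⟩
    exact (hAcl D).2 d hdA c (fun h => hc.1 ((hP c).2 ⟨D, h⟩)) e.symm
  have hZfin : Z.Finite := by
    have hcov : Z ⊆ F ∪ ⋃ D : (cayley G S).ComponentCompl F, Z ∩ (D : Set G) := by
      intro z hz
      by_cases hzF : z ∈ (F : Set G)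
      · exact Or.inl hzF
      · exact Or.inr (Set.mem_iUnion.2
          ⟨_, hz, (cayley G S).componentComplMk_mem hzF⟩)
    refine (F.finite_toSet.union (Set.finite_iUnion fun D => ?_)).subset hcov
    by_cases hD : D.supp.Infinite
    swap
    · exact (Set.not_infinite.1 hD).subset Set.inter_subset_right
    refine (hF (F ∪ P) Finset.subset_union_left D (Z ∩ D) (A ⟨D, hD⟩ \ ↑(F ∪ P))
      Set.inter_subset_right (Set.sdiff_subset.trans (hAD ⟨D, hD⟩)) ?_ ?_ ?_).resolve_right
      ((hAinf ⟨D, hD⟩).sdiff (Finset.finite_toSet _))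
    · exact Set.disjoint_left.2 fun z hz hzA => hz.1.2 _ hzA.1
    · refine ⟨Set.disjoint_left.2 fun z hz hzK => ?_, fun c hc d hd e => ?_⟩
      · rcases Finset.mem_union.1 hzK with h | h
        · exact SimpleGraph.ComponentCompl.notMem_of_mem hz.2 h
        · exact hz.1.1 h
      · exact ⟨hZ c hc.1 d (fun h => hd (Finset.mem_union_right _ h)) e,
          SimpleGraph.ComponentCompl.mem_of_adj c d hc.2
            (fun h => hd (Finset.mem_union_left _ h)) e⟩
    · refine ⟨Set.disjoint_sdiff_left, fun c hc d hd e => ⟨?_, hd⟩⟩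
      exact (hAcl ⟨D, hD⟩).2 c hc.1 d
        (fun h => hd (Finset.mem_union_right _ ((hP d).2 ⟨_, h⟩))) e
  refine ⟨fun n => if n = 1 then (P : Set G) else ∅, fun n _ => ?_,
    hZfin.subset (burnedSet_subset hXZ hZ)⟩
  by_cases hn : n = 1
  · simp only [hn, if_true, one_pow, mul_one, Set.ncard_coe_finset]
    exact ⟨P.finite_toSet, hPcard.trans (Nat.le_succ _)⟩
  · simp [hn]

theorem stmt13 (G : Type) [Group G] (S : Set G) (hS : IsFiniteGenSet S)
    (h : FiniteStepPolyRetaining (cayley G S) 0) :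
    ConstantContainment (cayley G S) ∨ (cayley G S).end.Infinite := by
  rcases finite_or_infinite G with hfinite | hinfinite
  · refine Or.inl ⟨1, one_pos, fun X0 _ => ⟨fun _ => ∅, fun n _ => by simp, Set.toFinite _⟩⟩
  refine or_iff_not_imp_right.2 fun hend => ?_
  have hend := Set.not_infinite.1 hend
  have : (cayley G S).LocallyFinite := fun a => (finite_neighborSet_cayley hS.1 a).fintype
  have hG := cayley_preconnected hS.2
  obtain ⟨F, h1, hFc, hF⟩ := exists_separatesEnds (cayley G S) hG hend 1
  by_cases hone : ∀ D D' : (cayley G S).ComponentCompl F,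
      D.supp.Infinite → D'.supp.Infinite → D = D'
  swap
  · push Not at hone
    obtain ⟨D₁, D₂, hD₁, hD₂, hne⟩ := hone
    exact constantContainment_of_separatesEnds hG h1 hFc hF hD₁ hD₂ hne
  obtain ⟨K, hK, hret⟩ := h
  refine ⟨K, hK, fun X0 hX0 => ?_⟩
  obtain ⟨W, ⟨hW, hgrowth⟩, N, hN⟩ := hret X0 hX0
  refine ⟨W, hW, (hF.finite_or_finite_compl hG hone (P := protectedUpTo W N) ?_ ?_).resolve_right
    (hgrowth.infinite hG)⟩
  · exact (Finset.finite_toSet _).biUnion fun i hi => (hW i (Finset.mem_Icc.1 hi).1).1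
  · exact fun c hc d hd e => mem_protectedUpTo_of_adj_burnedSet hN hc hd e
end
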